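/- Completeness of sum-of-squares refutations for explicitly compact infeasible systems: Let g_1,…,g_m and h_1,…,h_r be real polynomials in n variables such that for each variable index s ∈ {1,…,n} there is a real U_s with U_s − x_s² among the g_i (explicit compactness). If the set K = {x ∈ ℝ^n : g_i(x) ≥ 0 for all i, h_j(x) = 0 for all j} is empty, then there exist sum-of-squares polynomials σ_0, σ_1,…,σ_m and arbitrary polynomials q_1,…,q_r such that σ_0 + Σ_{i=1}^m σ_i·g_i + Σ_{j=1}^r q_j·h_j = −1 as polynomials. -/

import Mathlib

open MvPolynomial

/-- A polynomial is a sum of squares if it is a finite sum of squares of polynomials. -/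
def IsSOS {n : ℕ} (σ : MvPolynomial (Fin n) ℝ) : Prop :=
  ∃ (m : ℕ) (p : Fin m → MvPolynomial (Fin n) ℝ), σ = ∑ ℓ, (p ℓ) ^ 2

/-- A quadratic module of a commutative ring: a set containing `1` that is closed under addition
and under multiplication by squares. -/
structure IsQuadraticModule {A : Type*} [CommRing A] (Q : Set A) : Prop where
  one_mem : 1 ∈ Q
  add_mem : ∀ {a b : A}, a ∈ Q → b ∈ Q → a + b ∈ Q
  sq_mul_mem : ∀ (a : A) {b : A}, b ∈ Q → a ^ 2 * b ∈ Q

namespace IsQuadraticModule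

section CommRing

variable {A : Type*} [CommRing A] {Q : Set A}

lemma zero_mem (hQ : IsQuadraticModule Q) : 0 ∈ Q := by
  simpa using hQ.sq_mul_mem 0 hQ.one_mem

lemma sq_mem (hQ : IsQuadraticModule Q) (a : A) : a ^ 2 ∈ Q := by
  simpa using hQ.sq_mul_mem a hQ.one_mem

lemma isSumSq_mul_mem (hQ : IsQuadraticModule Q) {s b : A} (hs : IsSumSq s) (hb : b ∈ Q) :
    s * b ∈ Q := by
  induction hs with
  | zero => simpa using hQ.zero_mem
  | sq_add a _ ih =>
    rw [add_mul, ← sq]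
    exact hQ.add_mem (hQ.sq_mul_mem a hb) ih

lemma isSumSq_mem (hQ : IsQuadraticModule Q) {s : A} (hs : IsSumSq s) : s ∈ Q := by
  simpa using hQ.isSumSq_mul_mem hs hQ.one_mem

/-- The quadratic module generated by a quadratic module and one more element. -/
lemma adjoin (hQ : IsQuadraticModule Q) (f : A) :
    IsQuadraticModule {x | ∃ q ∈ Q, ∃ s, IsSumSq s ∧ x = q + s * f} where
  one_mem := ⟨1, hQ.one_mem, 0, .zero, by simp⟩
  add_mem := by
    rintro _ _ ⟨q, hq, s, hs, rfl⟩ ⟨q', hq', s', hs', rfl⟩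
    exact ⟨q + q', hQ.add_mem hq hq', s + s', hs.add hs', by ring⟩
  sq_mul_mem := by
    rintro a _ ⟨q, hq, s, hs, rfl⟩
    exact ⟨a ^ 2 * q, hQ.sq_mul_mem a hq, a ^ 2 * s, (IsSquare.sq a).isSumSq.mul hs, by ring⟩

/-- Every proper quadratic module is contained in a maximal one. -/
lemma exists_maximal (hQ : IsQuadraticModule Q) (hneg : -1 ∉ Q) :
    ∃ P, Q ⊆ P ∧ Maximal (fun P : Set A => IsQuadraticModule P ∧ -1 ∉ P) P := by
  refine zorn_subset_nonempty {P : Set A | IsQuadraticModule P ∧ -1 ∉ P} ?_ Q ⟨hQ, hneg⟩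
  rintro c hc hchain ⟨P₀, hP₀⟩
  refine ⟨⋃₀ c, ⟨⟨⟨P₀, hP₀, (hc hP₀).1.one_mem⟩, ?_, ?_⟩, ?_⟩, fun _ => Set.subset_sUnion_of_mem⟩
  · rintro a b ⟨P, hP, ha⟩ ⟨P', hP', hb⟩
    rcases hchain.total hP hP' with hle | hle
    · exact ⟨P', hP', (hc hP').1.add_mem (hle ha) hb⟩
    · exact ⟨P, hP, (hc hP).1.add_mem ha (hle hb)⟩
  · rintro a b ⟨P, hP, hb⟩
    exact ⟨P, hP, (hc hP).1.sq_mul_mem a hb⟩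
  · rintro ⟨P, hP, hmem⟩
    exact (hc hP).2 hmem

/-- An element outside a maximal proper quadratic module generates `-1` over it. -/
lemma exists_of_notMem_maximal
    (hmax : Maximal (fun P : Set A => IsQuadraticModule P ∧ -1 ∉ P) Q) {f : A} (hf : f ∉ Q) :
    ∃ q ∈ Q, ∃ s, IsSumSq s ∧ -1 = q + s * f := by
  by_contra hcon
  exact hf (hmax.2 ⟨hmax.1.1.adjoin f, hcon⟩ (fun q hq => ⟨q, hq, 0, .zero, by simp⟩)
    ⟨0, hmax.1.1.zero_mem, 1, IsSquare.one.isSumSq, by simp⟩)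

end CommRing

section Algebra

variable {A : Type*} [CommRing A] [Algebra ℝ A] {Q : Set A}

lemma algebraMap_mul_mem (hQ : IsQuadraticModule Q) {r : ℝ} (hr : 0 ≤ r) {a : A} (ha : a ∈ Q) :
    algebraMap ℝ A r * a ∈ Q := by
  rw [← Real.sq_sqrt hr, map_pow]
  exact hQ.sq_mul_mem _ ha

lemma algebraMap_mem (hQ : IsQuadraticModule Q) {r : ℝ} (hr : 0 ≤ r) : algebraMap ℝ A r ∈ Q := by
  simpa using hQ.algebraMap_mul_mem hr hQ.one_mem

lemma nonneg_of_algebraMap_mem (hQ : IsQuadraticModule Q) (hneg : -1 ∉ Q) {r : ℝ}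
    (hr : algebraMap ℝ A r ∈ Q) : 0 ≤ r := by
  by_contra! hlt
  have hmem := hQ.algebraMap_mul_mem (r := -r⁻¹) (by simpa using hlt.le) hr
  rw [← map_mul, neg_mul, inv_mul_cancel₀ hlt.ne] at hmem
  exact hneg (by simpa using hmem)

/-- The support `Q ∩ -Q` of a quadratic module in a real algebra, as an ideal. -/
def support (hQ : IsQuadraticModule Q) : Ideal A where
  carrier := {a | a ∈ Q ∧ -a ∈ Q}
  zero_mem' := by simpa using hQ.zero_mem
  add_mem' := by
    rintro a b ⟨ha, ha'⟩ ⟨hb, hb'⟩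
    exact ⟨hQ.add_mem ha hb, by rw [neg_add]; exact hQ.add_mem ha' hb'⟩
  smul_mem' := by
    rintro c a ⟨ha, ha'⟩
    have half : 2 * algebraMap ℝ A (1 / 2) = 1 := by
      rw [← map_ofNat (algebraMap ℝ A) 2, ← map_mul]
      norm_num
    set d := algebraMap ℝ A (1 / 2)
    constructor
    · convert hQ.add_mem (hQ.sq_mul_mem (d * (c + 1)) ha) (hQ.sq_mul_mem (d * (c - 1)) ha') using 1
      rw [smul_eq_mul]
      linear_combination (-(c * a) * (2 * d + 1)) * half
    · convert hQ.add_mem (hQ.sq_mul_mem (d * (c + 1)) ha') (hQ.sq_mul_mem (d * (c - 1)) ha) using 1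
      rw [smul_eq_mul]
      linear_combination ((c * a) * (2 * d + 1)) * half

lemma mem_support (hQ : IsQuadraticModule Q) {a : A} : a ∈ hQ.support ↔ a ∈ Q ∧ -a ∈ Q := Iff.rfl

/-- A maximal proper quadratic module is a total ordering. -/
lemma mem_or_neg_mem_of_maximal
    (hmax : Maximal (fun P : Set A => IsQuadraticModule P ∧ -1 ∉ P) Q) (f : A) :
    f ∈ Q ∨ -f ∈ Q := by
  have hQ := hmax.1.1
  by_contra! hcon
  obtain ⟨q, hq, s, hs, hqs⟩ := exists_of_notMem_maximal hmax hcon.1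
  obtain ⟨q', hq', s', hs', hqs'⟩ := exists_of_notMem_maximal hmax hcon.2
  have hsupp : s ∈ hQ.support := by
    refine ⟨hQ.isSumSq_mem hs, ?_⟩
    convert hQ.add_mem (hQ.isSumSq_mem hs')
      (hQ.add_mem (hQ.isSumSq_mul_mem hs hq') (hQ.isSumSq_mul_mem hs' hq)) using 1
    linear_combination s' * hqs + s * hqs'
  apply hmax.1.2
  rw [hqs]
  refine hQ.add_mem hq ?_
  rw [mul_comm]
  exact (hQ.support.mul_mem_left f hsupp).1

/-- The elements bounded above and below by a real constant with respect to a quadratic module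
form a subalgebra. -/
def boundedSubalgebra (hQ : IsQuadraticModule Q) : Subalgebra ℝ A where
  carrier := {a | ∃ N : ℝ, 0 < N ∧ algebraMap ℝ A N + a ∈ Q ∧ algebraMap ℝ A N - a ∈ Q}
  algebraMap_mem' r := by
    refine ⟨|r| + 1, by positivity, ?_, ?_⟩
    · rw [← map_add]
      exact hQ.algebraMap_mem (by linarith [neg_abs_le r])
    · rw [← map_sub]
      exact hQ.algebraMap_mem (by linarith [le_abs_self r])
  add_mem' := by
    rintro a b ⟨N, hN, ha, ha'⟩ ⟨L, hL, hb, hb'⟩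
    refine ⟨N + L, add_pos hN hL, ?_, ?_⟩
    · convert hQ.add_mem ha hb using 1
      rw [map_add]; ring
    · convert hQ.add_mem ha' hb' using 1
      rw [map_add]; ring
  mul_mem' := by
    have sq_bound : ∀ {a : A} {N : ℝ}, 0 < N → algebraMap ℝ A N + a ∈ Q →
        algebraMap ℝ A N - a ∈ Q → algebraMap ℝ A N ^ 2 - a ^ 2 ∈ Q := by
      intro a N hN ha ha'
      have hinv : 2 * algebraMap ℝ A N * algebraMap ℝ A (1 / (2 * N)) = 1 := by
        rw [← map_ofNat (algebraMap ℝ A) 2, ← map_mul, ← map_mul]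
        rw [mul_one_div_cancel (by positivity), map_one]
      convert hQ.algebraMap_mul_mem (r := 1 / (2 * N)) (by positivity)
        (hQ.add_mem (hQ.sq_mul_mem (algebraMap ℝ A N + a) ha')
          (hQ.sq_mul_mem (algebraMap ℝ A N - a) ha)) using 1
      linear_combination (a ^ 2 - algebraMap ℝ A N ^ 2) * hinv
    rintro a b ⟨N, hN, ha, ha'⟩ ⟨L, hL, hb, hb'⟩
    have hsum := sq_bound (a := a + b) (N := N + L) (by positivity)
      (by convert hQ.add_mem ha hb using 1; rw [map_add]; ring)
      (by convert hQ.add_mem ha' hb' using 1; rw [map_add]; ring)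
    have hdiff := sq_bound (a := a - b) (N := N + L) (by positivity)
      (by convert hQ.add_mem ha hb' using 1; rw [map_add]; ring)
      (by convert hQ.add_mem ha' hb using 1; rw [map_add]; ring)
    have quarter : 4 * algebraMap ℝ A (1 / 4) = 1 := by
      rw [← map_ofNat (algebraMap ℝ A) 4, ← map_mul]
      norm_num
    refine ⟨1 / 4 * (N + L) ^ 2, by positivity, ?_, ?_⟩
    · convert hQ.algebraMap_mul_mem (r := 1 / 4) (by norm_num)
        (hQ.add_mem hdiff (hQ.sq_mem (a + b))) using 1
      rw [map_mul, map_pow]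
      linear_combination -(a * b) * quarter
    · convert hQ.algebraMap_mul_mem (r := 1 / 4) (by norm_num)
        (hQ.add_mem hsum (hQ.sq_mem (a - b))) using 1
      rw [map_mul, map_pow]
      linear_combination (a * b) * quarter

lemma mem_boundedSubalgebra (hQ : IsQuadraticModule Q) {a : A} : a ∈ hQ.boundedSubalgebra ↔
    ∃ N : ℝ, 0 < N ∧ algebraMap ℝ A N + a ∈ Q ∧ algebraMap ℝ A N - a ∈ Q := Iff.rfl

lemma mem_boundedSubalgebra_of_sub_sq_mem (hQ : IsQuadraticModule Q) {a : A} {U : ℝ}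
    (ha : algebraMap ℝ A U - a ^ 2 ∈ Q) : a ∈ hQ.boundedSubalgebra := by
  have half : 2 * algebraMap ℝ A (1 / 2) = 1 := by
    rw [← map_ofNat (algebraMap ℝ A) 2, ← map_mul]
    norm_num
  have hle : algebraMap ℝ A (|U| - U) ∈ Q := hQ.algebraMap_mem (by linarith [le_abs_self U])
  have hmem : ∀ b : A, algebraMap ℝ A U - b ^ 2 ∈ Q →
      algebraMap ℝ A (|U| + (1 / 2) ^ 2) + b ∈ Q := by
    intro b hb
    convert hQ.add_mem hle (hQ.add_mem hb (hQ.sq_mem (b + algebraMap ℝ A (1 / 2)))) using 1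
    rw [map_add, map_sub, map_pow]
    linear_combination -b * half
  refine ⟨|U| + (1 / 2) ^ 2, by positivity, hmem a ha, ?_⟩
  rw [sub_eq_add_neg]
  exact hmem (-a) (by simpa using ha)

/-- An Archimedean maximal proper quadratic module is closed. -/
lemma mem_of_forall_pos_add_mem
    (hmax : Maximal (fun P : Set A => IsQuadraticModule P ∧ -1 ∉ P) Q)
    (htop : hmax.1.1.boundedSubalgebra = ⊤) {a : A}
    (ha : ∀ ε : ℝ, 0 < ε → a + algebraMap ℝ A ε ∈ Q) : a ∈ Q := by
  have hQ := hmax.1.1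
  by_contra hcon
  obtain ⟨q, hq, s, hs, hqs⟩ := exists_of_notMem_maximal hmax hcon
  obtain ⟨N, hN, -, hNs⟩ := hQ.mem_boundedSubalgebra.1 (htop ▸ Algebra.mem_top : s ∈ _)
  have hε : (0 : ℝ) < 1 / (2 * N) := by positivity
  have hmem := hQ.add_mem (hQ.add_mem hq (hQ.isSumSq_mul_mem hs (ha _ hε)))
    (hQ.algebraMap_mul_mem hε.le hNs)
  have hlt : algebraMap ℝ A (-1 + 1 / (2 * N) * N) ∈ Q := by
    convert hmem using 1
    rw [map_add, map_neg, map_one, map_mul]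
    linear_combination hqs
  have hnonneg := hQ.nonneg_of_algebraMap_mem hmax.1.2 hlt
  have : 1 / (2 * N) * N = 1 / 2 := by field_simp
  linarith

/-- Modulo the support of an Archimedean maximal proper quadratic module, every element is a real
constant. -/
lemma exists_sub_algebraMap_mem_support
    (hmax : Maximal (fun P : Set A => IsQuadraticModule P ∧ -1 ∉ P) Q)
    (htop : hmax.1.1.boundedSubalgebra = ⊤) (a : A) :
    ∃ r : ℝ, a - algebraMap ℝ A r ∈ hmax.1.1.support := by
  have hQ := hmax.1.1
  obtain ⟨N, hN, hNa, hNa'⟩ := hQ.mem_boundedSubalgebra.1 (htop ▸ Algebra.mem_top : a ∈ _)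
  set S := {r : ℝ | a - algebraMap ℝ A r ∈ Q}
  have hne : S.Nonempty := ⟨-N, by simpa [S, add_comm] using hNa⟩
  have hbdd : BddAbove S := by
    refine ⟨N, fun r (hr : a - algebraMap ℝ A r ∈ Q) => ?_⟩
    have hmem : algebraMap ℝ A (N - r) ∈ Q := by
      convert hQ.add_mem hNa' hr using 1
      rw [map_sub]; ring
    linarith [hQ.nonneg_of_algebraMap_mem hmax.1.2 hmem]
  refine ⟨sSup S, hQ.mem_support.2 ⟨?_, ?_⟩⟩
  · refine mem_of_forall_pos_add_mem hmax htop fun ε hε => ?_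
    obtain ⟨r, hr, hlt⟩ := exists_lt_of_lt_csSup hne (sub_lt_self (sSup S) hε)
    convert hQ.add_mem hr (hQ.algebraMap_mem (r := r - sSup S + ε) (by linarith)) using 1
    rw [map_add, map_sub]; ring
  · refine mem_of_forall_pos_add_mem hmax htop fun ε hε => ?_
    have hnot : sSup S + ε ∉ S := fun hmem => by linarith [le_csSup hbdd hmem]
    convert (mem_or_neg_mem_of_maximal hmax (a - algebraMap ℝ A (sSup S + ε))).resolve_left hnot
      using 1
    rw [map_add]; ring

end Algebra

/-- A proper quadratic module of a real polynomial ring in which the squares of the variables are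
bounded is nonnegative at some point. -/
lemma exists_forall_eval_nonneg {ι : Type*} {Q : Set (MvPolynomial ι ℝ)}
    (hQ : IsQuadraticModule Q) (hneg : -1 ∉ Q)
    (hbound : ∀ i, ∃ U : ℝ, C U - (X i : MvPolynomial ι ℝ) ^ 2 ∈ Q) :
    ∃ x : ι → ℝ, ∀ f ∈ Q, 0 ≤ eval x f := by
  obtain ⟨P, hQP, hmax⟩ := hQ.exists_maximal hneg
  have hP := hmax.1.1
  have htop : hP.boundedSubalgebra = ⊤ := by
    rw [eq_top_iff, ← MvPolynomial.adjoin_range_X, Algebra.adjoin_le_iff]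
    rintro _ ⟨i, rfl⟩
    obtain ⟨U, hU⟩ := hbound i
    exact hP.mem_boundedSubalgebra_of_sub_sq_mem (hQP hU)
  choose x hx using fun i => exists_sub_algebraMap_mem_support hmax htop (X i)
  refine ⟨x, fun f hf => ?_⟩
  have hquot : (Ideal.Quotient.mkₐ ℝ hP.support) =
      (Algebra.ofId ℝ (_ ⧸ hP.support)).comp (aeval x) := by
    ext i
    simp only [AlgHom.comp_apply, aeval_X, Ideal.Quotient.mkₐ_eq_mk]
    exact Ideal.Quotient.eq.2 (hx i)
  have hsupp : f - algebraMap ℝ _ (eval x f) ∈ hP.support :=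
    Ideal.Quotient.eq.1 (by
      rw [← aeval_eq_eval]
      exact DFunLike.congr_fun hquot f)
  refine hP.nonneg_of_algebraMap_mem hmax.1.2 ?_
  convert hP.add_mem (hQP hf) hsupp.2 using 1
  ring

end IsQuadraticModule

/-- The quadratic module generated by a family `g`, plus the ideal generated by a family `h`. -/
lemma isQuadraticModule_span {A ι κ : Type*} [CommRing A] [Fintype ι] [Fintype κ]
    (g : ι → A) (h : κ → A) :
    IsQuadraticModule {f | ∃ (σ₀ : A) (σ : ι → A) (q : κ → A),
      IsSumSq σ₀ ∧ (∀ i, IsSumSq (σ i)) ∧ σ₀ + ∑ i, σ i * g i + ∑ j, q j * h j = f} where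
  one_mem := ⟨1, 0, 0, IsSquare.one.isSumSq, fun _ => .zero, by simp⟩
  add_mem := by
    rintro _ _ ⟨σ₀, σ, q, hσ₀, hσ, rfl⟩ ⟨τ₀, τ, p, hτ₀, hτ, rfl⟩
    refine ⟨σ₀ + τ₀, σ + τ, q + p, hσ₀.add hτ₀, fun i => (hσ i).add (hτ i), ?_⟩
    simp only [Pi.add_apply, add_mul, Finset.sum_add_distrib]
    ring
  sq_mul_mem := by
    rintro a _ ⟨σ₀, σ, q, hσ₀, hσ, rfl⟩
    have ha : IsSumSq (a ^ 2) := (IsSquare.sq a).isSumSq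
    refine ⟨a ^ 2 * σ₀, fun i => a ^ 2 * σ i, fun j => a ^ 2 * q j, ha.mul hσ₀,
      fun i => ha.mul (hσ i), ?_⟩
    simp only [mul_add, Finset.mul_sum, mul_assoc]

lemma IsSumSq.isSOS {n : ℕ} {s : MvPolynomial (Fin n) ℝ} (hs : IsSumSq s) : IsSOS s := by
  induction hs with
  | zero => exact ⟨0, Fin.elim0, by simp⟩
  | sq_add a _ ih =>
    obtain ⟨k, p, rfl⟩ := ih
    exact ⟨k + 1, Fin.cons a p, by simp [Fin.sum_univ_succ, sq]⟩

/-- Completeness of sum-of-squares refutations for explicitly compact infeasible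
systems: if the explicitly compact system `{gᵢ ≥ 0}, {hⱼ = 0}` defines an empty set,
then it admits a sum-of-squares refutation. -/
theorem sos_refutation_completeness {n m r : ℕ}
    (g : Fin m → MvPolynomial (Fin n) ℝ) (h : Fin r → MvPolynomial (Fin n) ℝ)
    (hcompact : ∀ s : Fin n, ∃ (U : ℝ) (i : Fin m),
      g i = C U - (X s : MvPolynomial (Fin n) ℝ) ^ 2)
    (hempty : {x : Fin n → ℝ | (∀ i, 0 ≤ eval x (g i)) ∧ (∀ j, eval x (h j) = 0)} = ∅) :
    ∃ (σ₀ : MvPolynomial (Fin n) ℝ) (σ : Fin m → MvPolynomial (Fin n) ℝ)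
      (q : Fin r → MvPolynomial (Fin n) ℝ),
      IsSOS σ₀ ∧ (∀ i, IsSOS (σ i)) ∧
      σ₀ + ∑ i, σ i * g i + ∑ j, q j * h j = -1 := by
  by_contra hcon
  set Q := {f | ∃ (σ₀ : MvPolynomial (Fin n) ℝ) (σ : Fin m → MvPolynomial (Fin n) ℝ)
      (q : Fin r → MvPolynomial (Fin n) ℝ), IsSumSq σ₀ ∧ (∀ i, IsSumSq (σ i)) ∧
      σ₀ + ∑ i, σ i * g i + ∑ j, q j * h j = f}
  have hneg : -1 ∉ Q := by
    rintro ⟨σ₀, σ, q, hσ₀, hσ, heq⟩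
    exact hcon ⟨σ₀, σ, q, hσ₀.isSOS, fun i => (hσ i).isSOS, heq⟩
  have hg : ∀ i, g i ∈ Q := fun i => by
    refine ⟨0, Pi.single i 1, 0, .zero, fun k => ?_, by simp [Pi.single_apply]⟩
    obtain rfl | hk := eq_or_ne k i
    · simp
    · simp [hk]
  have hh : ∀ (c : MvPolynomial (Fin n) ℝ) (j), c * h j ∈ Q := fun c j =>
    ⟨0, 0, Pi.single j c, .zero, fun _ => .zero, by simp [Pi.single_apply]⟩
  obtain ⟨x, hx⟩ := (isQuadraticModule_span g h).exists_forall_eval_nonneg hneg fun s => by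
    obtain ⟨U, i, hi⟩ := hcompact s
    exact ⟨U, hi ▸ hg i⟩
  refine Set.eq_empty_iff_forall_notMem.1 hempty x ⟨fun i => hx _ (hg i), fun j => ?_⟩
  have hpos := hx _ (hh 1 j)
  have hnonpos := hx _ (hh (-1) j)
  simp only [map_mul, map_neg, map_one] at hpos hnonpos
  linarith
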